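/- arXiv:1802.08144 — 3 statements merged into one kernel-verified Lean document; each statement's English description precedes it below -/
import Mathlib

section
/- Let D be a quadrangulation of the (2s+2)-gon, F_D the associated frieze of type Λ_4, T_D the associated triangulation and F_{T_D} its Conway–Coxeter frieze. Then F_D and F_{T_D} coincide in every second row, namely in every odd-numbered row. -/
namespace FriezeNote

/-- `x` lies strictly between `a` and `b`, going in the positive direction
around the vertices `0, 1, …, m-1` of the `m`-gon. -/
def StrictBtw (m : ℕ) (a x b : ZMod m) : Prop :=
  0 < (x - a).val ∧ (x - a).val < (b - a).val

/-- Two chords of the `m`-gon cross (in the interior of the polygon). -/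
def Crosses (m : ℕ) (e f : Sym2 (ZMod m)) : Prop :=
  ∃ a b c d : ZMod m, e = s(a, b) ∧ f = s(c, d) ∧
    StrictBtw m a c b ∧ StrictBtw m b d a

/-- `e` is a diagonal of the `m`-gon: its endpoints are distinct and non-adjacent. -/
def IsDiagonal (m : ℕ) (e : Sym2 (ZMod m)) : Prop :=
  ∃ a b : ZMod m, e = s(a, b) ∧ a ≠ b ∧ b ≠ a + 1 ∧ a ≠ b + 1

/-- `e` is a boundary edge of the `m`-gon. -/
def IsPolyEdge (m : ℕ) (e : Sym2 (ZMod m)) : Prop :=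
  ∃ a : ZMod m, e = s(a, a + 1)

/-- A dissection of the `m`-gon: a set of pairwise non-crossing diagonals. -/
def IsDissection (m : ℕ) (D : Set (Sym2 (ZMod m))) : Prop :=
  (∀ e ∈ D, IsDiagonal m e) ∧ ∀ e ∈ D, ∀ f ∈ D, ¬ Crosses m e f

/-- `b` is the cyclic successor of `a` among the vertices of the finite set `C`:
both lie in `C` and no element of `C` lies strictly between them. -/
def CycConsec (m : ℕ) (C : Finset (ZMod m)) (a b : ZMod m) : Prop :=
  a ∈ C ∧ b ∈ C ∧ a ≠ b ∧ ∀ x ∈ C, ¬ StrictBtw m a x b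

/-- `C` is the vertex set of one of the subpolygons (cells) into which the
dissection `D` splits the `m`-gon: it has at least `3` vertices, cyclically
consecutive vertices of `C` are joined by a diagonal of `D` or a boundary edge,
and any diagonal of `D` with both endpoints in `C` joins cyclically consecutive
vertices of `C`. -/
def IsCell (m : ℕ) (D : Set (Sym2 (ZMod m))) (C : Finset (ZMod m)) : Prop :=
  3 ≤ C.card ∧
  (∀ a b : ZMod m, CycConsec m C a b → (s(a, b) ∈ D ∨ IsPolyEdge m s(a, b))) ∧
  (∀ a b : ZMod m, a ∈ C → b ∈ C → s(a, b) ∈ D →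
    (CycConsec m C a b ∨ CycConsec m C b a))

/-- `D` is a `p`-angulation of the `m`-gon: a dissection all of whose
subpolygons are `p`-gons. -/
def IsPAngulation (m p : ℕ) (D : Set (Sym2 (ZMod m))) : Prop :=
  IsDissection m D ∧ ∀ C : Finset (ZMod m), IsCell m D C → C.card = p

/-- The number of subpolygons of the dissection `D` incident with the vertex `α`. -/
noncomputable def cellCount (m : ℕ) (D : Set (Sym2 (ZMod m))) (α : ZMod m) : ℕ :=
  {C : Finset (ZMod m) | IsCell m D C ∧ α ∈ C}.ncard

/-- A frieze pattern of width `n`: rows numbered `0, …, n + 3` from below (entries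
of rows beyond `n + 3` are irrelevant), each row indexed by `ℤ`, rows `0` and
`n + 3` are zeroes, rows `1` and `n + 2` are ones, rows `2` through `n + 1` are
positive, and every diamond `b` (top), `a` (left), `d` (right), `c` (bottom)
satisfies `a * d - b * c = 1`. -/
structure Frieze (n : ℕ) where
  entry : ℕ → ℤ → ℝ
  nonneg : ∀ i k, i ≤ n + 3 → 0 ≤ entry i k
  row_zero : ∀ k, entry 0 k = 0
  row_top : ∀ k, entry (n + 3) k = 0
  row_one : ∀ k, entry 1 k = 1
  row_penult : ∀ k, entry (n + 2) k = 1
  row_pos : ∀ i k, 2 ≤ i → i ≤ n + 1 → 0 < entry i k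
  diamond : ∀ i k, 1 ≤ i → i ≤ n + 2 →
    entry i k * entry i (k + 1) - entry (i + 1) k * entry (i - 1) (k + 1) = 1

/-- `λ_p = 2 cos (π / p)`. -/
noncomputable def lambda (p : ℕ) : ℝ := 2 * Real.cos (Real.pi / p)

/-- A frieze pattern is of type `Λ_p` if every entry of its quiddity row (row `2`)
is a positive integral multiple of `λ_p`. -/
def IsTypeLambda (p : ℕ) {n : ℕ} (F : Frieze n) : Prop :=
  ∀ k : ℤ, ∃ q : ℕ, 0 < q ∧ F.entry 2 k = (q : ℝ) * lambda p

/-- `F` is the frieze of type `Λ_p` associated to the `p`-angulation `D` of the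
`m`-gon: its quiddity row is the periodic sequence `(λ_p q_0, …, λ_p q_{m-1})`. -/
def FriezeOfPAng (p m : ℕ) {n : ℕ} (F : Frieze n) (D : Set (Sym2 (ZMod m))) : Prop :=
  ∀ k : ℤ, F.entry 2 k = lambda p * (cellCount m D (k : ZMod m) : ℝ)

/-- `F` is the Conway–Coxeter frieze of the triangulation `T` of the `m`-gon:
its quiddity row is the periodic sequence `(t_0, …, t_{m-1})` where `t_α` is the
number of triangles of `T` incident with the vertex `α`. -/
def CCFrieze (m : ℕ) {n : ℕ} (F : Frieze n) (T : Set (Sym2 (ZMod m))) : Prop :=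
  ∀ k : ℤ, F.entry 2 k = (cellCount m T (k : ZMod m) : ℝ)

/-- A vertex of the `m`-gon is black when its label is odd (vertices are coloured
alternately, odd vertices black and even vertices white). -/
def IsBlack (m : ℕ) (a : ZMod m) : Prop := a.val % 2 = 1

/-- The set of chords joining two distinct black (odd) vertices of a common
subpolygon of the dissection `D`. -/
def oddPairs (m : ℕ) (D : Set (Sym2 (ZMod m))) : Set (Sym2 (ZMod m)) :=
  {e | ∃ (C : Finset (ZMod m)) (a b : ZMod m),
    IsCell m D C ∧ e = s(a, b) ∧ a ∈ C ∧ b ∈ C ∧ a ≠ b ∧ IsBlack m a ∧ IsBlack m b}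

/-- The triangulation associated to a dissection `D`: the diagonals of `D`
together with, inside each subpolygon, the chords joining pairs of its odd
(black) vertices. -/
def assocTriangulation (m : ℕ) (D : Set (Sym2 (ZMod m))) : Set (Sym2 (ZMod m)) :=
  D ∪ oddPairs m D

/-- `E` is a noncrossing tree on the black (odd) vertices of the `m`-gon:
its edges join distinct black vertices, are pairwise non-crossing, any two black
vertices are connected by a sequence of edges, and there is no loop of edges. -/
def IsNoncrossingTree (m : ℕ) (E : Set (Sym2 (ZMod m))) : Prop :=
  (∀ e ∈ E, ∃ a b : ZMod m, e = s(a, b) ∧ a ≠ b ∧ IsBlack m a ∧ IsBlack m b) ∧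
  (∀ e ∈ E, ∀ f ∈ E, ¬ Crosses m e f) ∧
  (∀ a b : ZMod m, IsBlack m a → IsBlack m b →
    (SimpleGraph.fromEdgeSet E).Reachable a b) ∧
  (SimpleGraph.fromEdgeSet E).IsAcyclic

/-- The inverse of the tree-of-quadrangulation map: it sends a noncrossing tree
`E` to the set of all black–white diagonals crossing no edge of `E`. -/
def quadOfTree (m : ℕ) (E : Set (Sym2 (ZMod m))) : Set (Sym2 (ZMod m)) :=
  {e | IsDiagonal m e ∧
    (∃ a b : ZMod m, e = s(a, b) ∧ IsBlack m a ∧ ¬ IsBlack m b) ∧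
    ∀ f ∈ E, ¬ Crosses m e f}

/-- `e` is a diagonal of the subpolygon with vertex set `C`: both endpoints are
distinct vertices of `C` which are not cyclically consecutive in `C`. -/
def CellDiagonal (m : ℕ) (C : Finset (ZMod m)) (e : Sym2 (ZMod m)) : Prop :=
  ∃ a b : ZMod m, e = s(a, b) ∧ a ∈ C ∧ b ∈ C ∧ a ≠ b ∧
    ¬ CycConsec m C a b ∧ ¬ CycConsec m C b a

/-- `e` is an edge of the subpolygon with vertex set `C`: it joins two
cyclically consecutive vertices of `C`. -/
def CellEdge (m : ℕ) (C : Finset (ZMod m)) (e : Sym2 (ZMod m)) : Prop :=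
  ∃ a b : ZMod m, e = s(a, b) ∧ (CycConsec m C a b ∨ CycConsec m C b a)

/-- `C` is an ear of the dissection `D`: a subpolygon all of whose edges except
exactly one are boundary edges of the polygon. -/
def IsEar (m : ℕ) (D : Set (Sym2 (ZMod m))) (C : Finset (ZMod m)) : Prop :=
  IsCell m D C ∧ ∃! e : Sym2 (ZMod m), CellEdge m C e ∧ ¬ IsPolyEdge m e

/-- The dual graph of a dissection `D`: vertices are the subpolygons of `D`, and
two subpolygons are adjacent when they share a common edge (a diagonal of `D`). -/
def dualGraph (m : ℕ) (D : Set (Sym2 (ZMod m))) :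
    SimpleGraph {C : Finset (ZMod m) // IsCell m D C} :=
  SimpleGraph.fromRel fun C C' =>
    ∃ e ∈ D, ∃ a b : ZMod m, e = s(a, b) ∧
      a ∈ C.1 ∧ b ∈ C.1 ∧ a ∈ C'.1 ∧ b ∈ C'.1

theorem val_sub_rot (m : ℕ) [NeZero m] (o x a : ZMod m) :
    ((x - a).val : ℤ) = if (a - o).val ≤ (x - o).val then ((x - o).val : ℤ) - (a - o).val
      else (x - o).val + m - (a - o).val := by
  have h : x - a = (x - o) - (a - o) := by ring
  rw [h]
  generalize x - o = X
  generalize a - o = A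
  split_ifs with hle
  · rw [ZMod.val_sub hle]; omega
  · have h1 : (X - A).val = m - (A - X).val := by
      have hne : A - X ≠ 0 := by
        intro h0
        have : A = X := sub_eq_zero.mp h0
        subst this; omega
      have : X - A = -(A - X) := by ring
      rw [this]
      have : NeZero (A - X) := ⟨hne⟩
      exact ZMod.val_neg_of_ne_zero (A - X)
    have h2 := ZMod.val_sub (a := A) (b := X) (by omega)
    have := ZMod.val_lt A
    have := ZMod.val_lt X
    omega

theorem sbtw_iff {m : ℕ} [NeZero m] (o a x b : ZMod m) :
    StrictBtw m a x b ↔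
      ((a - o).val < (x - o).val ∧ (x - o).val < (b - o).val) ∨
      ((x - o).val < (b - o).val ∧ (b - o).val < (a - o).val) ∨
      ((b - o).val < (a - o).val ∧ (a - o).val < (x - o).val) := by
  unfold StrictBtw
  have h1 := val_sub_rot m o x a
  have h2 := val_sub_rot m o b a
  have := ZMod.val_lt (x - o)
  have := ZMod.val_lt (a - o)
  have := ZMod.val_lt (b - o)
  split_ifs at h1 h2 <;> omega

theorem eq_iff_u {m : ℕ} [NeZero m] (o a b : ZMod m) : a = b ↔ (a - o).val = (b - o).val := by
  constructor
  · rintro rfl; rfl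
  · intro h
    have := ZMod.val_injective m h
    exact sub_left_injective this

theorem u_self {m : ℕ} (o : ZMod m) : (o - o).val = 0 := by simp

theorem succ_iff_u {m : ℕ} [NeZero m] (hm : 3 ≤ m) (o a b : ZMod m) : b = a + 1 ↔
    ((b - o).val = (a - o).val + 1 ∨ ((b - o).val = 0 ∧ (a - o).val + 1 = m)) := by
  have : Fact (1 < m) := ⟨by omega⟩
  rw [eq_iff_u o b (a + 1)]
  have e : a + 1 - o = (a - o) + 1 := by ring
  rw [e, ZMod.val_add, ZMod.val_one]
  have := ZMod.val_lt (a - o)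
  have := ZMod.val_lt (b - o)
  by_cases h : (a - o).val + 1 = m
  · rw [h, Nat.mod_self]; omega
  · rw [Nat.mod_eq_of_lt (by omega)]; omega

theorem polyEdge_iff {m : ℕ} (a b : ZMod m) : IsPolyEdge m s(a, b) ↔ (b = a + 1 ∨ a = b + 1) := by
  unfold IsPolyEdge
  constructor
  · rintro ⟨c, hc⟩
    rw [Sym2.eq_iff] at hc
    rcases hc with ⟨rfl, rfl⟩ | ⟨rfl, rfl⟩ <;> simp
  · rintro (rfl | rfl)
    · exact ⟨a, rfl⟩
    · exact ⟨b, Sym2.eq_swap⟩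

theorem diag_iff {m : ℕ} (a b : ZMod m) :
    IsDiagonal m s(a, b) ↔ (a ≠ b ∧ b ≠ a + 1 ∧ a ≠ b + 1) := by
  unfold IsDiagonal
  constructor
  · rintro ⟨c, d, hc, h⟩
    rw [Sym2.eq_iff] at hc
    rcases hc with ⟨rfl, rfl⟩ | ⟨rfl, rfl⟩
    · exact h
    · exact ⟨h.1.symm, h.2.2, h.2.1⟩
  · intro h; exact ⟨a, b, rfl, h⟩

/-- successor exists -/
theorem exists_succ {m : ℕ} [NeZero m] (C : Finset (ZMod m)) (hC : 2 ≤ C.card) (a : ZMod m)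
    (ha : a ∈ C) : ∃ b, CycConsec m C a b := by
  have hne : (C.erase a).Nonempty := by
    rw [← Finset.card_pos, Finset.card_erase_of_mem ha]; omega
  obtain ⟨b, hb, hmin⟩ := Finset.exists_min_image (C.erase a) (fun x => (x - a).val) hne
  have hb' := Finset.mem_erase.mp hb
  refine ⟨b, ha, hb'.2, hb'.1.symm, ?_⟩
  intro x hx hs
  have hxa : x ≠ a := by
    rintro rfl
    unfold StrictBtw at hs
    simp at hs
  have := hmin x (Finset.mem_erase.mpr ⟨hxa, hx⟩)
  unfold StrictBtw at hs
  omega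

theorem exists_gap {m : ℕ} [NeZero m] (C : Finset (ZMod m)) (hC : 2 ≤ C.card) (x : ZMod m)
    (hx : x ∉ C) : ∃ p q, CycConsec m C p q ∧ StrictBtw m p x q := by
  have hne : C.Nonempty := by rw [← Finset.card_pos]; omega
  obtain ⟨q, hq, hmin⟩ := Finset.exists_min_image C (fun y => (y - x).val) hne
  obtain ⟨p, hp, hmax⟩ := Finset.exists_max_image C (fun y => (y - x).val) hne
  obtain ⟨y, hy, z, hz, hyz⟩ := Finset.one_lt_card.mp (show 1 < C.card by omega)
  have h0 := u_self x
  have hqx : q ≠ x := by rintro rfl; exact hx hq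
  rw [Ne, eq_iff_u x] at hqx hyz
  have h1 := hmin y hy
  have h2 := hmin z hz
  have h3 := hmax y hy
  have h4 := hmax z hz
  refine ⟨p, q, ⟨hp, hq, ?_, ?_⟩, ?_⟩
  · rw [Ne, eq_iff_u x]; omega
  · intro w hw
    have h5 := hmin w hw
    have h6 := hmax w hw
    rw [sbtw_iff x]; omega
  · rw [sbtw_iff x]; omega

theorem noncross {m : ℕ} {D : Set (Sym2 (ZMod m))} (hD : IsDissection m D) {a b c d : ZMod m}
    (h1 : s(a, b) ∈ D) (h2 : s(c, d) ∈ D) (h3 : StrictBtw m a c b) (h4 : StrictBtw m b d a) :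
    False := hD.2 _ h1 _ h2 ⟨a, b, c, d, rfl, rfl, h3, h4⟩

theorem consec_mem {m : ℕ} [NeZero m] (hm : 3 ≤ m) {D : Set (Sym2 (ZMod m))}
    {C : Finset (ZMod m)} (hC : IsCell m D C)
    {p q x : ZMod m} (h : CycConsec m C p q) (hx : StrictBtw m p x q) : s(p, q) ∈ D := by
  rcases hC.2.1 p q h with h1 | h1
  · exact h1
  · exfalso
    rw [polyEdge_iff, succ_iff_u hm p, succ_iff_u hm p] at h1
    rw [sbtw_iff p] at hx
    have h0 := u_self p
    have := ZMod.val_lt (x - p)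
    rcases h1 with h1 | h1
    · omega
    · -- q = p - 1
      obtain ⟨hp, hq, hne, hno⟩ := h
      have hsub : C ⊆ {p, q} := by
        intro y hy
        have h2 := hno y hy
        rw [sbtw_iff p] at h2
        have := ZMod.val_lt (y - p)
        simp only [Finset.mem_insert, Finset.mem_singleton]
        rw [eq_iff_u p y p, eq_iff_u p y q]
        omega
      have := Finset.card_le_card hsub
      have := Finset.card_le_two (a := p) (b := q)
      have := hC.1
      omega

theorem cell_not_split_aux {m : ℕ} [NeZero m] (hm : 3 ≤ m) {D : Set (Sym2 (ZMod m))}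
    (hD : IsDissection m D) {C : Finset (ZMod m)} (hC : IsCell m D C) {c d x y : ZMod m}
    (hcd : s(c, d) ∈ D) (hx : x ∈ C) (hy : y ∈ C) (h1 : StrictBtw m c x d)
    (h2 : StrictBtw m d y c) : c ∈ C := by
  by_contra hc
  have hcard := hC.1
  obtain ⟨p, q, hpq, hb⟩ := exists_gap C (by omega) c hc
  have hpD := consec_mem hm hC hpq hb
  have hn : ¬ StrictBtw m q d p := fun h => noncross hD hpD hcd hb h
  have hnx := hpq.2.2.2 x hx
  have hny := hpq.2.2.2 y hy
  have h0 := u_self c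
  rw [sbtw_iff c] at h1 h2 hb hn hnx hny
  have a1 : (x - c).val < (d - c).val := by clear hb hn hnx hny; omega
  have a2 : (d - c).val < (y - c).val := by clear hb hn hnx hny; omega
  have a3 : (q - c).val < (p - c).val := by clear h1 h2 hn hnx hny; omega
  clear h1 h2 hb
  have a4 : (q - c).val ≤ (x - c).val := by clear hn hny; omega
  have a5 : (y - c).val ≤ (p - c).val := by clear hn hnx; omega
  omega

/-- K1 -/
theorem cell_not_split {m : ℕ} [NeZero m] (hm : 3 ≤ m) {D : Set (Sym2 (ZMod m))}
    (hD : IsDissection m D) {C : Finset (ZMod m)} (hC : IsCell m D C) {c d x y : ZMod m}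
    (hcd : s(c, d) ∈ D) (hx : x ∈ C) (hy : y ∈ C) (h1 : StrictBtw m c x d)
    (h2 : StrictBtw m d y c) : False := by
  have hc := cell_not_split_aux hm hD hC hcd hx hy h1 h2
  have hd := cell_not_split_aux hm hD hC (by rw [Sym2.eq_swap]; exact hcd) hy hx h2 h1
  rcases hC.2.2 c d hc hd hcd with h | h
  · exact h.2.2.2 x hx h1
  · exact h.2.2.2 y hy h2

/-- K2 -/
theorem cell_sep {m : ℕ} [NeZero m] (hm : 3 ≤ m) {D : Set (Sym2 (ZMod m))}
    (hD : IsDissection m D) {C C' : Finset (ZMod m)} (hC : IsCell m D C) (hC' : IsCell m D C')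
    {x : ZMod m} (hx : x ∈ C) (hx' : x ∉ C') :
    ∃ p q, CycConsec m C' p q ∧ StrictBtw m p x q ∧ ∀ z ∈ C, ¬ StrictBtw m q z p := by
  have hcard := hC'.1
  obtain ⟨p, q, hpq, hb⟩ := exists_gap C' (by omega) x hx'
  have hpD := consec_mem hm hC' hpq hb
  exact ⟨p, q, hpq, hb, fun z hz h => cell_not_split hm hD hC hpD hx hz hb h⟩

theorem two_consec {m : ℕ} [NeZero m] {C : Finset (ZMod m)} (hC : 3 ≤ C.card) {a b : ZMod m}
    (h1 : CycConsec m C a b) (h2 : CycConsec m C b a) : False := by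
  have h5 := h1.2.2.1
  rw [Ne, eq_iff_u a] at h5
  have hsub : C ⊆ {a, b} := by
    intro y hy
    have h3 := h1.2.2.2 y hy
    have h4 := h2.2.2.2 y hy
    rw [sbtw_iff a] at h3 h4
    have := u_self a
    simp only [Finset.mem_insert, Finset.mem_singleton]
    rw [eq_iff_u a y a, eq_iff_u a y b]
    omega
  have := Finset.card_le_card hsub
  have := Finset.card_le_two (a := a) (b := b)
  omega

theorem common_pq {m : ℕ} [NeZero m] {C' : Finset (ZMod m)} {p q z : ZMod m}
    (h : CycConsec m C' p q) (hz' : z ∈ C') (hz : ¬ StrictBtw m q z p) : z = p ∨ z = q := by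
  have h3 := h.2.2.2 z hz'
  have h4 := h.2.2.1
  rw [Ne, eq_iff_u p] at h4
  rw [sbtw_iff p] at h3 hz
  have := u_self p
  rw [eq_iff_u p z p, eq_iff_u p z q]
  omega

theorem cell_unique_sub {m : ℕ} [NeZero m] (hm : 3 ≤ m) {D : Set (Sym2 (ZMod m))}
    (hD : IsDissection m D) {C C' : Finset (ZMod m)} (hC : IsCell m D C) (hC' : IsCell m D C')
    {a b : ZMod m} (h : CycConsec m C a b) (h' : CycConsec m C' a b) : C ⊆ C' := by
  intro x hx
  by_contra hx'
  obtain ⟨p, q, hpq, hb, hall⟩ := cell_sep hm hD hC hC' hx hx'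
  have h1 := common_pq hpq h'.1 (hall a h.1)
  have h2 := common_pq hpq h'.2.1 (hall b h.2.1)
  have hne := h.2.2.1
  rcases h1 with rfl | rfl <;> rcases h2 with rfl | rfl
  · exact hne rfl
  · exact h.2.2.2 x hx hb
  · exact two_consec hC'.1 h' hpq
  · exact hne rfl

theorem cell_unique {m : ℕ} [NeZero m] (hm : 3 ≤ m) {D : Set (Sym2 (ZMod m))}
    (hD : IsDissection m D) {C C' : Finset (ZMod m)} (hC : IsCell m D C) (hC' : IsCell m D C')
    {a b : ZMod m} (h : CycConsec m C a b) (h' : CycConsec m C' a b) : C = C' :=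
  (cell_unique_sub hm hD hC hC' h h').antisymm (cell_unique_sub hm hD hC' hC h' h)

theorem succ_unique {m : ℕ} [NeZero m] {C : Finset (ZMod m)} {a b c : ZMod m}
    (h : CycConsec m C a b) (h' : CycConsec m C a c) : b = c := by
  have h1 := h.2.2.2 c h'.2.1
  have h2 := h'.2.2.2 b h.2.1
  have h3 := h.2.2.1
  have h4 := h'.2.2.1
  rw [sbtw_iff a] at h1 h2
  rw [Ne, eq_iff_u a] at h3 h4
  rw [eq_iff_u a]
  have := u_self a
  omega

/-- the vertices of the cell to one side of the chord from `a` to `b` -/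
theorem cell_exists {m : ℕ} [NeZero m] (hm : 3 ≤ m) {D : Set (Sym2 (ZMod m))}
    (hD : IsDissection m D) {a b : ZMod m} (hab : s(a, b) ∈ D ∨ IsPolyEdge m s(a, b))
    (hL : 2 ≤ (b - a).val) : ∃ C, IsCell m D C ∧ CycConsec m C b a := by
  classical
  have h0 := u_self a
  let cov : ZMod m → ZMod m → ZMod m → Prop := fun c x d =>
    s(c, d) ∈ D ∧ (c - a).val < (x - a).val ∧ (x - a).val < (d - a).val ∧
      (d - a).val ≤ (b - a).val ∧ ¬ (c = a ∧ d = b)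
  let C : Finset (ZMod m) := Finset.univ.filter fun x =>
    (x - a).val ≤ (b - a).val ∧ ¬ ∃ c d, cov c x d
  have memC : ∀ x, x ∈ C ↔ ((x - a).val ≤ (b - a).val ∧ ¬ ∃ c d, cov c x d) := by
    intro x; simp [C]
  have haC : a ∈ C := by
    rw [memC]
    refine ⟨by omega, ?_⟩
    rintro ⟨c, d, h⟩
    have := h.2.1
    omega
  have hbC : b ∈ C := by
    rw [memC]
    refine ⟨le_rfl, ?_⟩
    rintro ⟨c, d, h⟩
    have := h.2.2
    omega
  have key : ∀ x ∈ C, ∀ y ∈ C, (x - a).val < (y - a).val →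
      (∀ z ∈ C, ¬ ((x - a).val < (z - a).val ∧ (z - a).val < (y - a).val)) →
      (y - a).val = (x - a).val + 1 ∨ (s(x, y) ∈ D ∧ ¬ (x = a ∧ y = b)) := by
    intro x hx y hy hxy hz
    by_cases h1 : (y - a).val = (x - a).val + 1
    · exact Or.inl h1
    right
    have hx1 := (memC x).1 hx
    have hy1 := (memC y).1 hy
    have hxm := ZMod.val_lt (y - a)
    have hw := (succ_iff_u hm a x (x + 1)).1 rfl
    have hwv : (x + 1 - a).val = (x - a).val + 1 := by omega
    have hwC : x + 1 ∉ C := fun h => hz _ h (by omega)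
    have hwcov : ∃ c d, cov c (x + 1) d := by
      by_contra hcon
      exact hwC ((memC _).2 ⟨by omega, hcon⟩)
    have hne : (Finset.univ.filter fun d => ∃ c, cov c (x + 1) d).Nonempty := by
      obtain ⟨c, d, h⟩ := hwcov
      exact ⟨d, by simpa using ⟨c, h⟩⟩
    obtain ⟨d, hd, hmax⟩ := Finset.exists_max_image _ (fun d => (d - a).val) hne
    simp only [Finset.mem_filter, Finset.mem_univ, true_and] at hd hmax
    obtain ⟨c, hcD, hc1, hc2, hc3, hc4⟩ := hd
    have hcx : c = x := by
      by_contra hcx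
      rw [eq_iff_u a] at hcx
      exact hx1.2 ⟨c, d, hcD, by omega, by omega, hc3, hc4⟩
    subst hcx
    have hdy : d = y := by
      by_contra hdy
      rw [eq_iff_u a] at hdy
      have hlt : (d - a).val < (y - a).val := by
        by_contra hge
        exact hy1.2 ⟨c, d, hcD, by omega, by omega, hc3, hc4⟩
      have hdC : d ∉ C := fun h => hz _ h (by omega)
      have hdcov : ∃ c' d', cov c' d d' := by
        by_contra hcon
        exact hdC ((memC _).2 ⟨by omega, hcon⟩)
      obtain ⟨c', d', hD', h2, h3, h4, h5⟩ := hdcov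
      have hle : (c' - a).val ≤ (c - a).val := by
        by_contra hgt
        refine noncross hD hcD hD' ?_ ?_
        · rw [sbtw_iff a]; omega
        · rw [sbtw_iff a]; omega
      have := hmax d' ⟨c', hD', by omega, by omega, h4, h5⟩
      omega
    subst hdy
    exact ⟨hcD, hc4⟩
  have hcons : CycConsec m C b a := by
    refine ⟨hbC, haC, ?_, ?_⟩
    · rw [Ne, eq_iff_u a]; omega
    · intro x hx
      have := ((memC x).1 hx).1
      rw [sbtw_iff a]; omega
  refine ⟨C, ⟨?_, ?_, ?_⟩, hcons⟩
  · have : ∃ z ∈ C, (a - a).val < (z - a).val ∧ (z - a).val < (b - a).val := by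
      by_contra hcon
      push Not at hcon
      rcases key a haC b hbC (by omega) (fun z hz h => by have := hcon z hz h.1; omega) with h | h
      · omega
      · exact h.2 ⟨rfl, rfl⟩
    obtain ⟨z, hz, hz1, hz2⟩ := this
    have hsub : ({a, z, b} : Finset (ZMod m)) ⊆ C := by
      intro y hy
      simp only [Finset.mem_insert, Finset.mem_singleton] at hy
      rcases hy with rfl | rfl | rfl <;> assumption
    have hc : ({a, z, b} : Finset (ZMod m)).card = 3 := by
      rw [Finset.card_eq_three]
      refine ⟨a, z, b, ?_, ?_, ?_, rfl⟩ <;> rw [Ne, eq_iff_u a] <;> omega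
    have := Finset.card_le_card hsub
    omega
  · intro p q h
    have hp := ((memC p).1 h.1).1
    have hq := ((memC q).1 h.2.1).1
    rcases lt_or_ge (p - a).val (q - a).val with hlt | hge
    · rcases key p h.1 q h.2.1 hlt (fun z hz hh => h.2.2.2 z hz (by rw [sbtw_iff a]; omega))
        with h1 | h1
      · right
        rw [polyEdge_iff, succ_iff_u hm a]; omega
      · exact Or.inl h1.1
    · have hne := h.2.2.1
      have h1 := h.2.2.2 a haC
      have h2 := h.2.2.2 b hbC
      rw [Ne, eq_iff_u a] at hne
      rw [sbtw_iff a] at h1 h2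
      have e1 : p = b := by rw [eq_iff_u a]; omega
      have e2 : q = a := by rw [eq_iff_u a]; omega
      rw [e1, e2, Sym2.eq_swap]
      exact hab
  · have main : ∀ p q, p ∈ C → q ∈ C → s(p, q) ∈ D → (p - a).val < (q - a).val →
        (CycConsec m C p q ∨ CycConsec m C q p) := by
      intro p q hp hq hpq hlt
      by_cases h : p = a ∧ q = b
      · right; rw [h.1, h.2]; exact hcons
      · left
        refine ⟨hp, hq, ?_, ?_⟩
        · rw [Ne, eq_iff_u a]; omega
        · intro x hx hs
          have h1 := (memC x).1 hx
          have h2 := (memC q).1 hq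
          rw [sbtw_iff a] at hs
          exact h1.2 ⟨p, q, hpq, by omega, by omega, h2.1, h⟩
    intro p q hp hq hpq
    rcases lt_trichotomy (p - a).val (q - a).val with h | h | h
    · exact main p q hp hq hpq h
    · exfalso
      have := (diag_iff p q).1 (hD.1 _ hpq)
      exact this.1 ((eq_iff_u a p q).2 h)
    · rw [Sym2.eq_swap] at hpq
      exact (main q p hq hp hpq h).symm

theorem cellCount_eq {m : ℕ} [NeZero m] (hm : 3 ≤ m) {D : Set (Sym2 (ZMod m))}
    (hD : IsDissection m D) (α : ZMod m) :
    cellCount m D α = {β | s(α, β) ∈ D ∨ β = α + 1}.ncard := by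
  classical
  have hex : ∀ β, (s(α, β) ∈ D ∨ β = α + 1) → ∃ C, IsCell m D C ∧ CycConsec m C α β := by
    intro β hβ
    apply cell_exists hm hD
    · rcases hβ with h | h
      · left; rw [Sym2.eq_swap]; exact h
      · right; rw [polyEdge_iff]; exact Or.inr h
    · have h0 := u_self β
      have hlt := ZMod.val_lt (α - β)
      rcases hβ with h | h
      · have h1 := (diag_iff α β).1 (hD.1 _ h)
        simp only [Ne] at h1
        rw [succ_iff_u hm β, succ_iff_u hm β, eq_iff_u β] at h1
        omega
      · rw [succ_iff_u hm β] at h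
        omega
  have hex' : ∀ β, ∃ C, (s(α, β) ∈ D ∨ β = α + 1) → IsCell m D C ∧ CycConsec m C α β := by
    intro β
    by_cases h : (s(α, β) ∈ D ∨ β = α + 1)
    · obtain ⟨C, hC⟩ := hex β h
      exact ⟨C, fun _ => hC⟩
    · exact ⟨∅, fun h' => absurd h' h⟩
  choose f hf using hex'
  unfold cellCount
  have : {C : Finset (ZMod m) | IsCell m D C ∧ α ∈ C} = f '' {β | s(α, β) ∈ D ∨ β = α + 1} := by
    ext C
    simp only [Set.mem_ofPred_eq, Set.mem_image]
    constructor
    · rintro ⟨hC, hα⟩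
      have hcard := hC.1
      obtain ⟨β, hβ⟩ := exists_succ C (by omega) α hα
      have hβ' : s(α, β) ∈ D ∨ β = α + 1 := by
        by_cases hx : ∃ x, StrictBtw m α x β
        · obtain ⟨x, hx⟩ := hx
          exact Or.inl (consec_mem hm hC hβ hx)
        · right
          by_contra hne
          apply hx
          refine ⟨α + 1, ?_⟩
          have h1 := (succ_iff_u hm α α (α + 1)).1 rfl
          have h0 := u_self α
          have h2 := hβ.2.2.1
          rw [Ne, eq_iff_u α] at h2
          rw [succ_iff_u hm α] at hne
          rw [sbtw_iff α]; omega
      refine ⟨β, hβ', ?_⟩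
      exact cell_unique hm hD (hf β hβ').1 hC (hf β hβ').2 hβ
    · rintro ⟨β, hβ, rfl⟩
      exact ⟨(hf β hβ).1, (hf β hβ).2.1⟩
  rw [this]
  apply Set.InjOn.ncard_image
  intro β hβ γ hγ h
  have h1 := (hf β hβ).2
  have h2 := (hf γ hγ).2
  rw [h] at h1
  exact succ_unique h1 h2

theorem chord_odd {m : ℕ} [NeZero m] (hm : 3 ≤ m) {D : Set (Sym2 (ZMod m))}
    (hD : IsPAngulation m 4 D) : ∀ L : ℕ, ∀ a b : ZMod m, (b - a).val = L →
      (s(a, b) ∈ D ∨ IsPolyEdge m s(a, b)) → m % 2 = 0 → L % 2 = 1 := by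
  intro L
  induction L using Nat.strong_induction_on with
  | _ L ih =>
  intro a b hL hab hev
  have h0 := u_self a
  by_cases hL2 : 2 ≤ (b - a).val
  · obtain ⟨C, hC, hba⟩ := cell_exists hm hD.1 hab hL2
    have h4 := hD.2 C hC
    have inC : ∀ z ∈ C, (z - a).val ≤ (b - a).val := by
      intro z hz
      have := hba.2.2.2 z hz
      rw [sbtw_iff a] at this
      omega
    have next : ∀ p ∈ C, p ≠ b → ∃ q ∈ C, (p - a).val < (q - a).val ∧ CycConsec m C p q := by
      intro p hp hpb
      obtain ⟨q, hq⟩ := exists_succ C (by omega) p hp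
      refine ⟨q, hq.2.1, ?_, hq⟩
      have h1 := hq.2.2.2 b hba.1
      have h2 := inC p hp
      have h3 := hq.2.2.1
      rw [sbtw_iff a] at h1
      rw [Ne, eq_iff_u a] at hpb h3
      omega
    have hgap : ∀ p q, CycConsec m C p q → (p - a).val < (q - a).val → ∀ z ∈ C,
        (z - a).val ≤ (p - a).val ∨ (q - a).val ≤ (z - a).val := by
      intro p q hpq hlt z hz
      have := hpq.2.2.2 z hz
      rw [sbtw_iff a] at this
      omega
    have step : ∀ p q, CycConsec m C p q → (p - a).val < (q - a).val →
        (q - a).val - (p - a).val < L → ((q - a).val - (p - a).val) % 2 = 1 := by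
      intro p q hpq hlt hlL
      refine ih _ hlL p q ?_ (hC.2.1 p q hpq) hev
      have := val_sub_rot m a q p
      rw [if_pos (by omega)] at this
      omega
    have hab' : a ≠ b := by rw [Ne, eq_iff_u a]; omega
    obtain ⟨x, hx, hax, hcx⟩ := next a hba.2.1 hab'
    have hxb : x ≠ b := by
      rintro rfl; exact two_consec hC.1 hcx hba
    obtain ⟨y, hy, hxy, hcy⟩ := next x hx hxb
    have hyb : y ≠ b := by
      rintro rfl
      have hsub : C ⊆ {a, x, y} := by
        intro z hz
        have h1 := hgap _ _ hcx hax z hz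
        have h2 := hgap _ _ hcy hxy z hz
        have h3 := inC z hz
        simp only [Finset.mem_insert, Finset.mem_singleton]
        rw [eq_iff_u a z a, eq_iff_u a z x, eq_iff_u a z y]
        omega
      have := Finset.card_le_card hsub
      have := Finset.card_le_three (a := a) (b := x) (c := y)
      omega
    obtain ⟨z, hz, hyz, hcz⟩ := next y hy hyb
    have hzb : z = b := by
      by_contra hzb
      have hzb' := inC z hz
      rw [eq_iff_u a] at hzb
      have hsub : ({a, x, y, z, b} : Finset (ZMod m)) ⊆ C := by
        intro w hw
        simp only [Finset.mem_insert, Finset.mem_singleton] at hw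
        rcases hw with rfl | rfl | rfl | rfl | rfl
        exacts [hba.2.1, hx, hy, hz, hba.1]
      have := Finset.card_le_card hsub
      rw [Finset.card_insert_of_notMem, Finset.card_insert_of_notMem,
        Finset.card_insert_of_notMem, Finset.card_pair] at this
      · omega
      · rw [Ne, eq_iff_u a]; omega
      all_goals
        simp only [Finset.mem_insert, Finset.mem_singleton]
        simp only [eq_iff_u a]
        omega
    subst hzb
    have s1 := step _ _ hcx hax (by omega)
    have s2 := step _ _ hcy hxy (by omega)
    have s3 := step _ _ hcz hyz (by omega)
    omega
  · rcases hab with h | h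
    · have h1 := (diag_iff a b).1 (hD.1.1 _ h)
      simp only [Ne] at h1
      rw [succ_iff_u hm a, succ_iff_u hm a, eq_iff_u a] at h1
      omega
    · rw [polyEdge_iff, succ_iff_u hm a, succ_iff_u hm a] at h
      omega

theorem black_ne {m : ℕ} [NeZero m] (hm : 3 ≤ m) (hev : m % 2 = 0) {D : Set (Sym2 (ZMod m))}
    (hD : IsPAngulation m 4 D) {a b : ZMod m} (h : s(a, b) ∈ D ∨ IsPolyEdge m s(a, b)) :
    IsBlack m a ↔ ¬ IsBlack m b := by
  have h1 := chord_odd hm hD _ a b rfl h hev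
  have h2 := val_sub_rot m 0 b a
  simp only [sub_zero] at h2
  unfold IsBlack
  have := ZMod.val_lt a
  split_ifs at h2 <;> omega

theorem consec_black {m : ℕ} [NeZero m] (hm : 3 ≤ m) (hev : m % 2 = 0) {D : Set (Sym2 (ZMod m))}
    (hD : IsPAngulation m 4 D) {C : Finset (ZMod m)} (hC : IsCell m D C) {a b : ZMod m}
    (h : CycConsec m C a b) : IsBlack m a ↔ ¬ IsBlack m b :=
  black_ne hm hev hD (hC.2.1 a b h)

theorem pred_unique {m : ℕ} [NeZero m] {C : Finset (ZMod m)} {a b c : ZMod m}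
    (h : CycConsec m C b a) (h' : CycConsec m C c a) : b = c := by
  have h1 := h.2.2.2 c h'.1
  have h2 := h'.2.2.2 b h.1
  have h3 := h.2.2.1
  have h4 := h'.2.2.1
  rw [sbtw_iff a] at h1 h2
  rw [Ne, eq_iff_u a] at h3 h4
  rw [eq_iff_u a]
  have := u_self a
  omega

theorem two_black {m : ℕ} [NeZero m] (hm : 3 ≤ m) (hev : m % 2 = 0) {D : Set (Sym2 (ZMod m))}
    (hD : IsPAngulation m 4 D) {C : Finset (ZMod m)} (hC : IsCell m D C) {a c d : ZMod m}
    (ha : a ∈ C) (hc : c ∈ C) (hd : d ∈ C) (ba : IsBlack m a) (bc : IsBlack m c)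
    (bd : IsBlack m d) (hac : a ≠ c) : d = a ∨ d = c := by
  by_contra hcon
  push Not at hcon
  have h4 := hD.2 C hC
  obtain ⟨a', ha'⟩ := exists_succ C (by omega) a ha
  obtain ⟨c', hc'⟩ := exists_succ C (by omega) c hc
  have ba' := (consec_black hm hev hD hC ha').1 ba
  have bc' := (consec_black hm hev hD hC hc').1 bc
  have hne : a' ≠ c' := by
    rintro rfl
    exact hac (pred_unique ha' hc')
  have hsub : ({a, c, d, a', c'} : Finset (ZMod m)) ⊆ C := by
    intro w hw
    simp only [Finset.mem_insert, Finset.mem_singleton] at hw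
    rcases hw with rfl | rfl | rfl | rfl | rfl
    exacts [ha, hc, hd, ha'.2.1, hc'.2.1]
  have := Finset.card_le_card hsub
  rw [Finset.card_insert_of_notMem, Finset.card_insert_of_notMem,
    Finset.card_insert_of_notMem, Finset.card_pair hne] at this
  · omega
  all_goals
    simp only [Finset.mem_insert, Finset.mem_singleton]
    rintro h
  · rcases h with rfl | rfl
    exacts [ba' bd, bc' bd]
  · rcases h with rfl | rfl | rfl
    exacts [hcon.2 rfl, ba' bc, bc' bc]
  · rcases h with rfl | rfl | rfl | rfl
    exacts [hac rfl, hcon.1 rfl, ba' ba, bc' ba]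

theorem other_black {m : ℕ} [NeZero m] (hm : 3 ≤ m) (hev : m % 2 = 0) {D : Set (Sym2 (ZMod m))}
    (hD : IsPAngulation m 4 D) {C : Finset (ZMod m)} (hC : IsCell m D C) {a : ZMod m}
    (ha : a ∈ C) (ba : IsBlack m a) : ∃ b ∈ C, b ≠ a ∧ IsBlack m b := by
  have h4 := hD.2 C hC
  obtain ⟨x, hx⟩ := exists_succ C (by omega) a ha
  obtain ⟨y, hy⟩ := exists_succ C (by omega) x hx.2.1
  have h1 := consec_black hm hev hD hC hx
  have h2 := consec_black hm hev hD hC hy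
  refine ⟨y, hy.2.1, ?_, by tauto⟩
  rintro rfl
  exact two_consec hC.1 hx hy

theorem mem_oddPairs {m : ℕ} {D : Set (Sym2 (ZMod m))} (a b : ZMod m) :
    s(a, b) ∈ oddPairs m D ↔ ∃ C, IsCell m D C ∧ a ∈ C ∧ b ∈ C ∧ a ≠ b ∧
      IsBlack m a ∧ IsBlack m b := by
  constructor
  · rintro ⟨C, c, d, hC, he, hc, hd, hne, bc, bd⟩
    rw [Sym2.eq_iff] at he
    rcases he with ⟨rfl, rfl⟩ | ⟨rfl, rfl⟩
    · exact ⟨C, hC, hc, hd, hne, bc, bd⟩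
    · exact ⟨C, hC, hd, hc, hne.symm, bd, bc⟩
  · rintro ⟨C, hC, ha, hb, hne, ba, bb⟩
    exact ⟨C, a, b, hC, rfl, ha, hb, hne, ba, bb⟩

theorem sbtw_swap_cross {m : ℕ} [NeZero m] {a b c d : ZMod m} (h1 : StrictBtw m a c b)
    (h2 : StrictBtw m b d a) : StrictBtw m c b d ∧ StrictBtw m d a c := by
  rw [sbtw_iff a] at *
  have := u_self a
  rw [sbtw_iff a d a c]
  omega

theorem assoc_dissection {m : ℕ} [NeZero m] (hm : 3 ≤ m) (hev : m % 2 = 0)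
    {D : Set (Sym2 (ZMod m))} (hD : IsPAngulation m 4 D) :
    IsDissection m (assocTriangulation m D) := by
  constructor
  · intro e he
    rcases he with he | he
    · exact hD.1.1 e he
    · induction e using Sym2.ind with
      | _ a b =>
      rw [mem_oddPairs] at he
      obtain ⟨C, hC, ha, hb, hne, ba, bb⟩ := he
      rw [diag_iff]
      refine ⟨hne, ?_, ?_⟩
      · intro h
        exact (black_ne hm hev hD (Or.inr ((polyEdge_iff a b).2 (Or.inl h)))).1 ba bb
      · intro h
        exact (black_ne hm hev hD (Or.inr ((polyEdge_iff a b).2 (Or.inr h)))).1 ba bb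
  · rintro e he f hf ⟨a, b, c, d, rfl, rfl, h1, h2⟩
    rcases he with he | he <;> rcases hf with hf | hf
    · exact noncross hD.1 he hf h1 h2
    · rw [mem_oddPairs] at hf
      obtain ⟨C, hC, hc, hd, -⟩ := hf
      exact cell_not_split hm hD.1 hC he hc hd h1 h2
    · rw [mem_oddPairs] at he
      obtain ⟨C, hC, ha, hb, -⟩ := he
      obtain ⟨h3, h4⟩ := sbtw_swap_cross h1 h2
      exact cell_not_split hm hD.1 hC hf hb ha h3 h4
    · rw [mem_oddPairs] at he hf
      obtain ⟨C, hC, ha, hb, hab, ba, bb⟩ := he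
      obtain ⟨C', hC', hc, hd, hcd, bc, bd⟩ := hf
      have h0 := u_self a
      by_cases hcC : c ∈ C
      · have h3 := two_black hm hev hD hC ha hb hcC ba bb bc hab
        rw [sbtw_iff a] at h1
        rw [eq_iff_u a, eq_iff_u a] at h3
        omega
      · obtain ⟨p, q, hpq, hx, hall⟩ := cell_sep hm hD.1 hC' hC hc hcC
        have k1 := hall d hd
        have k2 := hpq.2.2.2 a ha
        have k3 := hpq.2.2.2 b hb
        rw [sbtw_iff a] at h1 h2 hx k1 k2 k3
        have j1 : (c - a).val < (b - a).val := by clear h2 hx k1 k2 k3; omega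
        have j2 : (b - a).val < (d - a).val := by clear h1 hx k1 k2 k3; omega
        clear h1 h2
        omega

theorem odd_count {m : ℕ} [NeZero m] (hm : 3 ≤ m) (hev : m % 2 = 0)
    {D : Set (Sym2 (ZMod m))} (hD : IsPAngulation m 4 D) {α : ZMod m} (hα : IsBlack m α) :
    {β | s(α, β) ∈ oddPairs m D}.ncard = cellCount m D α := by
  have hex : ∀ C, ∃ b, (IsCell m D C ∧ α ∈ C) → (b ∈ C ∧ b ≠ α ∧ IsBlack m b) := by
    intro C
    by_cases h : IsCell m D C ∧ α ∈ C
    · obtain ⟨b, hb⟩ := other_black hm hev hD h.1 h.2 hα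
      exact ⟨b, fun _ => hb⟩
    · exact ⟨α, fun h' => absurd h' h⟩
  choose g hg using hex
  have himg : {β | s(α, β) ∈ oddPairs m D} = g '' {C | IsCell m D C ∧ α ∈ C} := by
    ext β
    simp only [Set.mem_ofPred_eq, Set.mem_image, mem_oddPairs]
    constructor
    · rintro ⟨C, hC, ha, hb, hne, -, bb⟩
      refine ⟨C, ⟨hC, ha⟩, ?_⟩
      have h := hg C ⟨hC, ha⟩
      rcases two_black hm hev hD hC ha hb h.1 hα bb h.2.2 hne with h1 | h1
      · exact absurd h1 h.2.1
      · exact h1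
    · rintro ⟨C, hC, rfl⟩
      have h := hg C hC
      exact ⟨C, hC.1, hC.2, h.1, h.2.1.symm, hα, h.2.2⟩
  rw [himg]
  unfold cellCount
  apply Set.InjOn.ncard_image
  have sub : ∀ C C', IsCell m D C ∧ α ∈ C → IsCell m D C' ∧ α ∈ C' → g C = g C' → C ⊆ C' := by
    intro C C' h h' hgg x hx
    by_contra hx'
    obtain ⟨p, q, hpq, hb, hall⟩ := cell_sep hm hD.1 h.1 h'.1 hx hx'
    have e := hg C h
    have e' := hg C' h'
    rw [← hgg] at e'
    have h1 := common_pq hpq h'.2 (hall α h.2)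
    have h2 := common_pq hpq e'.1 (hall _ e.1)
    have hne := e.2.1
    have hbl := consec_black hm hev hD h'.1 hpq
    have hb2 := e.2.2
    rcases h1 with h1 | h1 <;> rcases h2 with h2 | h2
    · exact hne (h2.trans h1.symm)
    · rw [h2] at hb2; rw [h1] at hα; exact hbl.1 hα hb2
    · rw [h2] at hb2; rw [h1] at hα; exact hbl.1 hb2 hα
    · exact hne (h2.trans h1.symm)
  intro C hC C' hC' h
  exact (sub C C' hC hC' h).antisymm (sub C' C hC' hC h.symm)

theorem count_assoc {m : ℕ} [NeZero m] (hm : 3 ≤ m) (hev : m % 2 = 0)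
    {D : Set (Sym2 (ZMod m))} (hD : IsPAngulation m 4 D) (α : ZMod m) :
    cellCount m (assocTriangulation m D) α =
      cellCount m D α + {β | s(α, β) ∈ oddPairs m D}.ncard := by
  rw [cellCount_eq hm (assoc_dissection hm hev hD), cellCount_eq hm hD.1]
  have : {β | s(α, β) ∈ assocTriangulation m D ∨ β = α + 1} =
      {β | s(α, β) ∈ D ∨ β = α + 1} ∪ {β | s(α, β) ∈ oddPairs m D} := by
    ext β
    simp only [Set.mem_ofPred_eq, Set.mem_union, assocTriangulation]
    tauto
  rw [this]
  refine Set.ncard_union_eq ?_ (Set.toFinite _) (Set.toFinite _)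
  rw [Set.disjoint_left]
  intro β h1 h2
  simp only [Set.mem_ofPred_eq, mem_oddPairs] at h1 h2
  obtain ⟨C, -, -, -, -, ba, bb⟩ := h2
  refine (black_ne hm hev hD ?_).1 ba bb
  rcases h1 with h | h
  · exact Or.inl h
  · exact Or.inr ((polyEdge_iff _ _).2 (Or.inl h))

theorem count_white {m : ℕ} [NeZero m] (hm : 3 ≤ m) (hev : m % 2 = 0)
    {D : Set (Sym2 (ZMod m))} (hD : IsPAngulation m 4 D) (α : ZMod m) (hα : ¬ IsBlack m α) :
    cellCount m (assocTriangulation m D) α = cellCount m D α := by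
  rw [count_assoc hm hev hD]
  have : {β | s(α, β) ∈ oddPairs m D} = ∅ := by
    ext β
    simp only [Set.mem_ofPred_eq, mem_oddPairs, Set.mem_empty_iff_false, iff_false]
    rintro ⟨C, -, -, -, -, ba, bb⟩
    exact hα ba
  rw [this, Set.ncard_empty, add_zero]

theorem black_cast (s : ℕ) (k : ℤ) : IsBlack (2 * s + 2) (k : ZMod (2 * s + 2)) ↔ k % 2 = 1 := by
  unfold IsBlack
  have h := ZMod.val_intCast (n := 2 * s + 2) k
  have h2 : k % ((2 * s + 2 : ℕ) : ℤ) % 2 = k % 2 := by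
    apply Int.emod_emod_of_dvd
    exact ⟨s + 1, by push_cast; ring⟩
  omega

theorem lambda_four : lambda 4 = √2 := by
  unfold lambda
  push_cast
  rw [Real.cos_pi_div_four]
  ring

theorem frieze_cmp (n : ℕ) (F G : Frieze n)
    (h0 : ∀ k : ℤ, k % 2 = 0 → F.entry 2 k = √2 * G.entry 2 k)
    (h1 : ∀ k : ℤ, k % 2 = 1 → √2 * F.entry 2 k = G.entry 2 k) :
    ∀ i, i ≤ n + 3 → (i % 2 = 1 → ∀ k, F.entry i k = G.entry i k) ∧
      (i % 2 = 0 → ∀ k : ℤ, (k % 2 = 0 → F.entry i k = √2 * G.entry i k) ∧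
        (k % 2 = 1 → √2 * F.entry i k = G.entry i k)) := by
  have hsq : √2 * √2 = 2 := Real.mul_self_sqrt (by norm_num)
  have hpos : (0 : ℝ) < √2 := by positivity
  intro i
  induction i using Nat.strong_induction_on with
  | _ i ih =>
  intro hi
  match i, ih, hi with
  | 0, _, _ => simp [F.row_zero, G.row_zero]
  | 1, _, _ => simp [F.row_one, G.row_one]
  | 2, _, _ =>
    refine ⟨by omega, fun _ k => ⟨h0 k, h1 k⟩⟩
  | (j + 3), ih, hi =>
    have A := ih (j + 2) (by omega) (by omega)
    have B := ih (j + 1) (by omega) (by omega)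
    have dF : ∀ k, F.entry (j + 2) k * F.entry (j + 2) (k + 1)
        - F.entry (j + 3) k * F.entry (j + 1) (k + 1) = 1 :=
      fun k => F.diamond (j + 2) k (by omega) (by omega)
    have dG : ∀ k, G.entry (j + 2) k * G.entry (j + 2) (k + 1)
        - G.entry (j + 3) k * G.entry (j + 1) (k + 1) = 1 :=
      fun k => G.diamond (j + 2) k (by omega) (by omega)
    have pG : ∀ k, 0 < G.entry (j + 1) k := by
      intro k
      rcases Nat.eq_zero_or_pos j with rfl | hj
      · rw [G.row_one]; norm_num
      · exact G.row_pos _ _ (by omega) (by omega)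
    constructor
    · intro hodd k
      have hB := B.1 (by omega) (k + 1)
      have d1 := dF k
      have d2 := dG k
      have e : F.entry (j + 2) k * F.entry (j + 2) (k + 1)
          = G.entry (j + 2) k * G.entry (j + 2) (k + 1) := by
        have ev := A.2 (by omega)
        rcases Int.emod_two_eq_zero_or_one k with hk | hk
        · rw [(ev k).1 hk, ← (ev (k + 1)).2 (by omega)]; ring
        · rw [(ev (k + 1)).1 (by omega), ← (ev k).2 hk]; ring
      rw [hB] at d1
      apply mul_right_cancel₀ (pG (k + 1)).ne'
      linarith
    · intro heven k
      have a1 := A.1 (by omega) k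
      have a2 := A.1 (by omega) (k + 1)
      have d1 := dF k
      have d2 := dG k
      rw [a1, a2] at d1
      have e : F.entry (j + 3) k * F.entry (j + 1) (k + 1)
          = G.entry (j + 3) k * G.entry (j + 1) (k + 1) := by linarith
      constructor
      · intro hk
        have b := (B.2 (by omega) (k + 1)).2 (by omega)
        rw [← b] at e
        have p := pG (k + 1)
        rw [← b] at p
        have p' := pos_of_mul_pos_right p hpos.le
        apply mul_right_cancel₀ p'.ne'
        rw [e]; ring
      · intro hk
        have b := (B.2 (by omega) (k + 1)).1 (by omega)
        rw [b] at e
        apply mul_right_cancel₀ (pG (k + 1)).ne'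
        rw [← e]; ring

/-- For a quadrangulation `D` of the `(2s+2)`-gon, the frieze `F` of type `Λ_4`
associated to `D` and the Conway–Coxeter frieze `G` of the associated
triangulation `T_D` coincide in every odd-numbered row. -/
theorem stmt7 (s : ℕ) (hs : 1 ≤ s) (D : Set (Sym2 (ZMod (2 * s + 2))))
    (hD : IsPAngulation (2 * s + 2) 4 D)
    (F G : Frieze (2 * s - 1))
    (hF : FriezeOfPAng 4 (2 * s + 2) F D)
    (hG : CCFrieze (2 * s + 2) G (assocTriangulation (2 * s + 2) D)) :
    ∀ i ≤ 2 * s + 2, Odd i → ∀ k : ℤ, F.entry i k = G.entry i k := by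
  have hev : (2 * s + 2) % 2 = 0 := by omega
  have hsq : √2 * √2 = 2 := Real.mul_self_sqrt (by norm_num)
  intro i hi hodd k
  refine (frieze_cmp (2 * s - 1) F G ?_ ?_ i (by omega)).1 (Nat.odd_iff.mp hodd) k
  · intro k hk
    rw [hF k, hG k, lambda_four, count_white (by omega) hev hD _ (by rw [black_cast]; omega)]
  · intro k hk
    rw [hF k, hG k, lambda_four, count_assoc (by omega) hev hD,
      odd_count (by omega) hev hD ((black_cast s k).2 hk), ← mul_assoc, hsq]
    push_cast
    ring

end FriezeNote
end

section
/- Let D be a quadrangulation of the (2s+2)-gon, F_D its frieze of type Λ_4 and F_{T_D} the Conway–Coxeter frieze of the associated triangulation, and set λ = √2. Suppose for some j ≥ 1 that rows 2j+1 of F_D and F_{T_D} coincide with positive integer entries b_0,…,b_{2s+1}, that row 2j+2 of F_D has entries λa_0, λa_1, …, λa_{2s+1} with positive integers a_α, and that row 2j+2 of F_{T_D} has entries a_0, 2a_1, a_2, 2a_3, …, a_{2s}, 2a_{2s+1}. Then rows 2j+3 of F_D and F_{T_D} coincide, with entries (2 a_k a_{k+1} − 1)/b_{k+1} (indices modulo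 2s+2), and all of these entries are positive integers. -/
namespace FriezeNote

theorem Frieze.pos_aux {n : ℕ} (G : Frieze n) (i : ℕ) (k : ℤ) (h1 : 1 ≤ i) (h2 : i ≤ n + 2) :
    0 < G.entry i k := by
  rcases Nat.lt_or_ge i 2 with h | h
  · obtain rfl : i = 1 := by omega
    rw [G.row_one]; norm_num
  · rcases Nat.lt_or_ge i (n + 2) with h' | h'
    · exact G.row_pos i k h (by omega)
    · obtain rfl : i = n + 2 := by omega
      rw [G.row_penult]; norm_num

theorem Frieze.rec_aux {n : ℕ} (G : Frieze n) (i : ℕ) : i + 1 ≤ n + 2 → ∀ k : ℤ,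
    G.entry (i + 2) k = G.entry 2 (k + i) * G.entry (i + 1) k - G.entry i k := by
  induction i with
  | zero => intro _ k; simp [G.row_one, G.row_zero]
  | succ i ih =>
    intro hi k
    have d2 := G.diamond (i + 2) k (by omega) (by omega)
    have d1 := G.diamond (i + 1) k (by omega) (by omega)
    have r := ih (by omega) (k + 1)
    have p := G.pos_aux (i + 1) (k + 1) (by omega) (by omega)
    simp only [Nat.add_sub_cancel, show i + 2 - 1 = i + 1 by omega] at d1 d2
    have e : k + ((i + 1 : ℕ) : ℤ) = k + 1 + i := by push_cast; ring
    rw [e]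
    apply mul_right_cancel₀ p.ne'
    simp only [show i + 1 + 2 = i + 2 + 1 by omega, show i + 1 + 1 = i + 2 by omega] at *
    linear_combination (G.entry (i + 2) k) * r - d2 + d1

theorem Frieze.int_aux {n : ℕ} (G : Frieze n) (h : ∀ k, ∃ z : ℤ, G.entry 2 k = z) (i : ℕ) :
    i ≤ n + 2 → ∀ k : ℤ, (∃ z : ℤ, G.entry i k = z) ∧ (∃ z : ℤ, G.entry (i + 1) k = z) := by
  induction i with
  | zero => intro _ k; exact ⟨⟨0, by simp [G.row_zero]⟩, ⟨1, by simp [G.row_one]⟩⟩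
  | succ i ih =>
    intro hi k
    obtain ⟨⟨x, hx⟩, ⟨y, hy⟩⟩ := ih (by omega) k
    obtain ⟨c, hc⟩ := h (k + i)
    refine ⟨⟨y, hy⟩, ⟨c * y - x, ?_⟩⟩
    have := G.rec_aux i hi k
    rw [hc, hx, hy] at this
    push_cast
    exact this

/-- The odd-row induction step for `p = 4`: if rows `2j+1` of `F = F_D` and
`G = F_{T_D}` coincide with positive integer entries `b_k`, row `2j+2` of `F`
has entries `λ a_k` (`λ = √2`, `a_k` positive integers) and row `2j+2` of `G`
has entries `a_k` at even positions and `2 a_k` at odd positions, then rows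
`2j+3` of `F` and `G` coincide, with entries `(2 a_k a_{k+1} - 1) / b_{k+1}`
(indices modulo `2s+2`), and all of these entries are positive integers. -/
theorem stmt10 (s : ℕ) (hs : 1 ≤ s) (D : Set (Sym2 (ZMod (2 * s + 2))))
    (hD : IsPAngulation (2 * s + 2) 4 D)
    (F G : Frieze (2 * s - 1))
    (hF : FriezeOfPAng 4 (2 * s + 2) F D)
    (hG : CCFrieze (2 * s + 2) G (assocTriangulation (2 * s + 2) D))
    (j : ℕ) (hj : 1 ≤ j) (hjs : 2 * j + 3 ≤ 2 * s + 2)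
    (a b : ZMod (2 * s + 2) → ℤ)
    (ha : ∀ α, 0 < a α) (hb : ∀ α, 0 < b α)
    (hFb : ∀ k : ℤ, F.entry (2 * j + 1) k = (b (k : ZMod (2 * s + 2)) : ℝ))
    (hGb : ∀ k : ℤ, G.entry (2 * j + 1) k = (b (k : ZMod (2 * s + 2)) : ℝ))
    (hFa : ∀ k : ℤ, F.entry (2 * j + 2) k =
      Real.sqrt 2 * (a (k : ZMod (2 * s + 2)) : ℝ))
    (hGaEven : ∀ k : ℤ, Even k →
      G.entry (2 * j + 2) k = (a (k : ZMod (2 * s + 2)) : ℝ))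
    (hGaOdd : ∀ k : ℤ, Odd k →
      G.entry (2 * j + 2) k = 2 * (a (k : ZMod (2 * s + 2)) : ℝ)) :
    ∀ k : ℤ,
      F.entry (2 * j + 3) k = G.entry (2 * j + 3) k ∧
      F.entry (2 * j + 3) k =
        (2 * (a (k : ZMod (2 * s + 2)) : ℝ) * (a ((k + 1 : ℤ) : ZMod (2 * s + 2)) : ℝ) - 1) /
          (b ((k + 1 : ℤ) : ZMod (2 * s + 2)) : ℝ) ∧
      ∃ z : ℤ, 0 < z ∧ F.entry (2 * j + 3) k = (z : ℝ) := by
  intro k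
  have hbpos : (0 : ℝ) < (b ((k + 1 : ℤ) : ZMod (2 * s + 2)) : ℝ) := by exact_mod_cast hb _
  have dF := F.diamond (2 * j + 2) k (by omega) (by omega)
  have dG := G.diamond (2 * j + 2) k (by omega) (by omega)
  simp only [show 2 * j + 2 - 1 = 2 * j + 1 by omega,
    show 2 * j + 2 + 1 = 2 * j + 3 by omega] at dF dG
  rw [hFa, hFa, hFb] at dF
  have h2 : Real.sqrt 2 * Real.sqrt 2 = 2 := Real.mul_self_sqrt (by norm_num)
  have eG : G.entry (2 * j + 2) k * G.entry (2 * j + 2) (k + 1) =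
      2 * (a (k : ZMod (2 * s + 2)) : ℝ) * (a ((k + 1 : ℤ) : ZMod (2 * s + 2)) : ℝ) := by
    rcases Int.even_or_odd k with hk | hk
    · rw [hGaEven k hk, hGaOdd (k + 1) hk.add_one]; ring
    · rw [hGaOdd k hk, hGaEven (k + 1) hk.add_one]
  rw [eG, hGb] at dG
  have f1 : F.entry (2 * j + 3) k = (2 * (a (k : ZMod (2 * s + 2)) : ℝ) *
      (a ((k + 1 : ℤ) : ZMod (2 * s + 2)) : ℝ) - 1) /
        (b ((k + 1 : ℤ) : ZMod (2 * s + 2)) : ℝ) := by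
    rw [eq_div_iff hbpos.ne']
    linear_combination (a (k : ZMod (2 * s + 2)) : ℝ) *
      (a ((k + 1 : ℤ) : ZMod (2 * s + 2)) : ℝ) * h2 - dF
  have g1 : G.entry (2 * j + 3) k = (2 * (a (k : ZMod (2 * s + 2)) : ℝ) *
      (a ((k + 1 : ℤ) : ZMod (2 * s + 2)) : ℝ) - 1) /
        (b ((k + 1 : ℤ) : ZMod (2 * s + 2)) : ℝ) := by
    rw [eq_div_iff hbpos.ne']
    linear_combination - dG
  have fg := f1.trans g1.symm
  refine ⟨fg, f1, ?_⟩
  obtain ⟨z, hz⟩ := (G.int_aux (fun k => ⟨_, (hG k).trans (Int.cast_natCast _).symm⟩)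
    (2 * j + 3) (by omega) k).1
  have hp := G.pos_aux (2 * j + 3) k (by omega) (by omega)
  refine ⟨z, ?_, fg.trans hz⟩
  rw [hz] at hp
  exact_mod_cast hp

end FriezeNote
end

section
/- A frieze pattern of width n is uniquely determined by its quiddity row: if two frieze patterns of width n have the same quiddity row (row number 2), then all their rows coincide. -/
namespace FriezeNote

/-- A frieze pattern of width `n` is uniquely determined by its quiddity row:
if two frieze patterns of width `n` have the same quiddity row (row `2`),
then all their rows coincide. -/
theorem stmt11 (n : ℕ) (hn : 0 < n) (F G : Frieze n)
    (h : ∀ k : ℤ, F.entry 2 k = G.entry 2 k) :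
    ∀ i ≤ n + 3, ∀ k : ℤ, F.entry i k = G.entry i k := by
  intro i
  induction i using Nat.strong_induction_on with
  | _ i ih =>
    intro hi k
    match i, ih, hi with
    | 0, _, _ => rw [F.row_zero, G.row_zero]
    | 1, _, _ => rw [F.row_one, G.row_one]
    | 2, _, _ => exact h k
    | j + 3, ih, hi =>
      have hF := F.diamond (j + 2) k (by omega) (by omega)
      have hG := G.diamond (j + 2) k (by omega) (by omega)
      have e : j + 2 - 1 = j + 1 := by omega
      rw [e] at hF hG
      rw [ih (j + 2) (by omega) (by omega) k, ih (j + 2) (by omega) (by omega) (k + 1),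
        ih (j + 1) (by omega) (by omega) (k + 1)] at hF
      have hpos : 0 < G.entry (j + 1) (k + 1) := by
        rcases Nat.eq_zero_or_pos j with rfl | hj
        · have := G.row_one (k + 1)
          simp [this]
        · exact G.row_pos (j + 1) (k + 1) (by omega) (by omega)
      have hm : F.entry (j + 3) k * G.entry (j + 1) (k + 1)
          = G.entry (j + 3) k * G.entry (j + 1) (k + 1) := by
        linarith
      exact mul_right_cancel₀ hpos.ne' hm

end FriezeNote
end
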